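/- Let α_1, …, α_ℓ ∈ R with ℓ ≥ 2, let (x_n)_{n≥0} be an (α_1, …, α_ℓ)-orbit in T = R/Z taking infinitely many values, and let K be the closure of {x_n : n ≥ 0}. Set r = dim_Q span_Q(1, α_1, …, α_ℓ) − 1. If r > 1, then the lower box-counting dimension of K is at least 1/(r+1). -/

import Mathlib

open Filter Metric Set Pointwise

/-- The smallest number of arcs of length `δ` (closed balls of radius `δ/2`)
needed to cover `A`. -/
noncomputable def coverNum {X : Type*} [PseudoMetricSpace X] (A : Set X) (δ : ℝ) : ℕ :=
  sInf {n : ℕ | ∃ S : Finset X, S.card = n ∧ A ⊆ ⋃ x ∈ S, Metric.closedBall x (δ / 2)}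

/-- Lower box-counting dimension: liminf_{δ→0⁺} log N_δ(A) / log(1/δ). -/
noncomputable def lowerBoxDim {X : Type*} [PseudoMetricSpace X] (A : Set X) : ℝ :=
  Filter.liminf (fun δ : ℝ => Real.log (coverNum A δ) / Real.log (1 / δ))
    (nhdsWithin 0 (Set.Ioi 0))

/-- Let a real sequence be partitioned into cells by `c`. Each term `X t - X 0` is approximated,
with an error of at most `η` per cell visited before `t`, by a sum of one step per cell visited.
The coordinates `φ` of this sum are integers bounded by `B` times the number of cells. -/
theorem exists_short_label {s : ℕ} (X : ℕ → ℝ) (c : ℕ → ℤ) (η : ℝ) (B : ℕ)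
    (φ : ℝ →ₗ[ℚ] (Fin s → ℚ)) (V : Submodule ℚ ℝ)
    (hη : ∀ m n, c m = c n → |X m - X n| ≤ η)
    (hV : ∀ m n, c m = c n → X m - X n ∈ V)
    (hφ : ∀ n i, ∃ z : ℤ, φ (X (n + 1) - X n) i = z ∧ |z| ≤ B) (t : ℕ) :
    ∃ g : ℝ, (∀ i, ∃ z : ℤ, φ g i = z ∧ |z| ≤ ((Finset.range t).image c).card * B) ∧
      |g - (X t - X 0)| ≤ ((Finset.range t).image c).card * η ∧ g - (X t - X 0) ∈ V := by
  induction t using Nat.strong_induction_on with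
  | _ t ih =>
  rcases t with _ | t
  · exact ⟨0, fun i => ⟨0, by simp⟩, by simp, by simp⟩
  classical
  have hex : ∃ m, c m = c t := ⟨t, rfl⟩
  obtain ⟨u, hu, hmin⟩ : ∃ u, c u = c t ∧ ∀ m < u, c m ≠ c t :=
    ⟨Nat.find hex, Nat.find_spec hex, fun m hm => Nat.find_min hex hm⟩
  have hut : u ≤ t := by
    by_contra h
    exact hmin t (by omega) rfl
  have hcard : ((Finset.range u).image c).card + 1 ≤ ((Finset.range (t + 1)).image c).card := by
    apply Finset.card_lt_card
    rw [Finset.ssubset_iff_of_subset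
      (Finset.image_subset_image (Finset.range_subset_range.2 (by omega)))]
    refine ⟨c t, Finset.mem_image_of_mem _ (by simp), ?_⟩
    simp only [Finset.mem_image, Finset.mem_range, not_exists, not_and]
    exact hmin
  have hη0 : 0 ≤ η := (abs_nonneg _).trans (hη 0 0 rfl)
  obtain ⟨g, hg1, hg2, hg3⟩ := ih u (by omega)
  have heq : g + (X (t + 1) - X t) - (X (t + 1) - X 0)
      = (g - (X u - X 0)) + (X u - X t) := by ring
  refine ⟨g + (X (t + 1) - X t), fun i => ?_, ?_, ?_⟩
  · obtain ⟨z, hz, hzB⟩ := hg1 i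
    obtain ⟨w, hw, hwB⟩ := hφ t i
    refine ⟨z + w, by rw [map_add, Pi.add_apply, hz, hw]; push_cast; ring, ?_⟩
    calc |z + w| ≤ |z| + |w| := abs_add_le _ _
      _ ≤ ((Finset.range u).image c).card * B + B := add_le_add hzB hwB
      _ = (((Finset.range u).image c).card + 1 : ℕ) * (B : ℤ) := by push_cast; ring
      _ ≤ _ := by gcongr
  · rw [heq]
    calc _ ≤ |g - (X u - X 0)| + |X u - X t| := abs_add_le _ _
      _ ≤ ((Finset.range u).image c).card * η + η := add_le_add hg2 (hη _ _ hu)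
      _ = (((Finset.range u).image c).card + 1 : ℕ) * η := by push_cast; ring
      _ ≤ _ := by gcongr
  · rw [heq]
    exact V.add_mem hg3 (hV _ _ hu)

/-- The span of the differences within cells is generated by elements which are small and whose
coordinates are small integers, both linearly in the number of cells. -/
theorem exists_short_cycles {s : ℕ} (X : ℕ → ℝ) (c : ℕ → ℤ) (η : ℝ) (B : ℕ)
    (φ : ℝ →ₗ[ℚ] (Fin s → ℚ)) (hfin : (range c).Finite)
    (hη : ∀ m n, c m = c n → |X m - X n| ≤ η)
    (hφ : ∀ n i, ∃ z : ℤ, φ (X (n + 1) - X n) i = z ∧ |z| ≤ B) :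
    ∃ v : ℕ → ℝ,
      Submodule.span ℚ (range v) = Submodule.span ℚ {y | ∃ m n, c m = c n ∧ y = X m - X n} ∧
      (∀ n i, ∃ z : ℤ, φ (v n) i = z ∧ |z| ≤ 4 * (range c).ncard * B) ∧
      ∀ n, |v n| ≤ 4 * (range c).ncard * η := by
  classical
  set V := Submodule.span ℚ {y | ∃ m n, c m = c n ∧ y = X m - X n} with hVdef
  set N := (range c).ncard with hN
  have hV : ∀ m n, c m = c n → X m - X n ∈ V := fun m n h =>
    Submodule.subset_span ⟨m, n, h, rfl⟩
  have hη0 : 0 ≤ η := (abs_nonneg _).trans (hη 0 0 rfl)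
  have hN1 : 1 ≤ N := by
    exact (Set.ncard_pos hfin).2 (range_nonempty c)
  have hcard : ∀ t, ((Finset.range t).image c).card ≤ N := fun t => by
    rw [← Set.ncard_coe_finset]
    refine Set.ncard_le_ncard ?_ hfin
    rw [Finset.coe_image]
    exact image_subset_range _ _
  choose g hg1 hg2 hg3 using exists_short_label X c η B φ V hη hV hφ
  have hex : ∀ n, ∃ m, c m = c n := fun n => ⟨n, rfl⟩
  obtain ⟨p, hpc, hp1, hp2, hp3⟩ : ∃ p : ℕ → ℝ, (∀ m n, c m = c n → p m = p n) ∧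
      (∀ n i, ∃ z : ℤ, φ (p n) i = z ∧ |z| ≤ N * B) ∧
      (∀ n, |p n - (X n - X 0)| ≤ (N + 1) * η) ∧ ∀ n, p n - (X n - X 0) ∈ V := by
    have hc : ∀ n, c (Nat.find (hex n)) = c n := fun n => Nat.find_spec (hex n)
    have heq : ∀ n, g (Nat.find (hex n)) - (X n - X 0) =
        (g (Nat.find (hex n)) - (X (Nat.find (hex n)) - X 0)) + (X (Nat.find (hex n)) - X n) :=
      fun n => by ring
    refine ⟨fun n => g (Nat.find (hex n)), fun m n h => ?_, fun n i => ?_, fun n => ?_,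
      fun n => ?_⟩
    · simp only [h]
    · obtain ⟨z, hz, hzB⟩ := hg1 (Nat.find (hex n)) i
      refine ⟨z, hz, hzB.trans ?_⟩
      gcongr
      exact hcard _
    · rw [heq]
      calc _ ≤ _ + _ := abs_add_le _ _
        _ ≤ ((Finset.range (Nat.find (hex n))).image c).card * η + η :=
          add_le_add (hg2 _) (hη _ _ (hc n))
        _ ≤ N * η + η := by gcongr; exact hcard _
        _ = _ := by ring
    · rw [heq]
      exact V.add_mem (hg3 _) (hV _ _ (hc n))
  have hval : ∀ n, p n + (X (n + 1) - X n) - p (n + 1) =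
      (p n - (X n - X 0)) - (p (n + 1) - (X (n + 1) - X 0)) := fun n => by ring
  refine ⟨fun n => p n + (X (n + 1) - X n) - p (n + 1), le_antisymm ?_ ?_, fun n i => ?_,
    fun n => ?_⟩
  · rw [Submodule.span_le]
    rintro _ ⟨n, rfl⟩
    simp only [hval]
    exact V.sub_mem (hp3 _) (hp3 _)
  · rw [hVdef, Submodule.span_le]
    rintro _ ⟨m, n, hmn, rfl⟩
    set W := Submodule.span ℚ (range fun n => p n + (X (n + 1) - X n) - p (n + 1))
    have hW : ∀ n, (X n - p n) - (X 0 - p 0) ∈ W := fun n => by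
      induction n with
      | zero => simp
      | succ n ih =>
        have := W.add_mem ih (Submodule.subset_span (mem_range_self n))
        convert this using 1
        ring
    have := W.sub_mem (hW m) (hW n)
    rw [hpc m n hmn] at this
    rw [SetLike.mem_coe]
    convert this using 1
    ring
  · obtain ⟨z, hz, hzB⟩ := hp1 n i
    obtain ⟨w, hw, hwB⟩ := hφ n i
    obtain ⟨z', hz', hzB'⟩ := hp1 (n + 1) i
    refine ⟨z + w - z', ?_, ?_⟩
    · rw [map_sub, map_add, Pi.sub_apply, Pi.add_apply, hz, hw, hz']
      push_cast
      ring
    · calc |z + w - z'| ≤ |z| + |w| + |z'| :=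
          (abs_sub _ _).trans (add_le_add_left (abs_add_le _ _) _)
        _ ≤ N * B + 1 * B + N * B := by rw [one_mul]; gcongr
        _ ≤ N * B + N * B + N * B := by gcongr; exact_mod_cast hN1
        _ ≤ 4 * N * B := by nlinarith [mul_nonneg (Int.natCast_nonneg N) (Int.natCast_nonneg B)]
  · simp only [hval]
    have h1 : (1 : ℝ) ≤ N := by exact_mod_cast hN1
    calc _ ≤ |p n - (X n - X 0)| + |p (n + 1) - (X (n + 1) - X 0)| := abs_sub _ _
      _ ≤ (N + 1) * η + (N + 1) * η := add_le_add (hp2 _) (hp2 _)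
      _ ≤ (N + N) * η + (N + N) * η := by gcongr
      _ = _ := by ring

/-- If independent integer combinations of the `b i` with coefficients at most `K` are all at most
`K * η`, then Cramer's rule bounds each `b i`. -/
theorem abs_coeff_le_of_small_forms {s : ℕ} (b v : Fin s → ℝ) (A : Matrix (Fin s) (Fin s) ℤ)
    (hv : LinearIndependent ℚ v) (hA : ∀ j, v j = ∑ i, (A j i : ℝ) * b i) (K η : ℝ)
    (hη : 0 < η) (hK : ∀ j i, |(A j i : ℝ)| ≤ K) (hvK : ∀ j, |v j| ≤ K * η) (i : Fin s) :
    |b i| ≤ s.factorial * K ^ s * η := by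
  have hdet : A.det ≠ 0 := by
    intro h0
    obtain ⟨w, hw0, hw⟩ := Matrix.exists_vecMul_eq_zero_iff.2 h0
    apply hw0
    have hsum : ∑ j, (w j : ℚ) • v j = 0 := by
      have : ∀ j, (w j : ℚ) • v j = ∑ i, ((w j : ℝ) * A j i) * b i := fun j => by
        rw [hA, Rat.smul_def, Finset.mul_sum]
        refine Finset.sum_congr rfl fun i _ => ?_
        push_cast
        ring
      simp_rw [this]
      rw [Finset.sum_comm]
      refine Finset.sum_eq_zero fun i _ => ?_
      rw [← Finset.sum_mul]
      have h := congrFun hw i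
      simp only [Matrix.vecMul, dotProduct, Pi.zero_apply] at h
      have h' : ∑ j, (w j : ℝ) * A j i = 0 := by exact_mod_cast h
      rw [h', zero_mul]
    funext j
    have := Fintype.linearIndependent_iff.1 hv (fun j => (w j : ℚ)) hsum j
    exact_mod_cast this
  set R : Matrix (Fin s) (Fin s) ℝ := A.map (Int.cast : ℤ → ℝ) with hR
  have hRdet : R.det = (A.det : ℝ) := ((Int.castRingHom ℝ).map_det A).symm
  have hmul : R.mulVec b = v := by
    funext j
    rw [hA j]
    rfl
  have hcr : R.det * b i = (R.updateCol i v).det := by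
    rw [← Matrix.cramer_apply, Matrix.cramer_eq_adjugate_mulVec, ← hmul, Matrix.mulVec_mulVec,
      Matrix.adjugate_mul, Matrix.smul_mulVec, Matrix.one_mulVec]
    rfl
  have hscale : v = η • (η⁻¹ • v) := by rw [smul_smul, mul_inv_cancel₀ hη.ne', one_smul]
  have hbound : |(R.updateCol i (η⁻¹ • v)).det| ≤ s.factorial * K ^ s := by
    have := Matrix.det_le (A := R.updateCol i (η⁻¹ • v)) (abv := AbsoluteValue.abs) (x := K)
      (fun j k => ?_)
    · simpa using this
    · by_cases hk : k = i
      · subst hk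
        simp only [Matrix.updateCol_self, Pi.smul_apply, smul_eq_mul, AbsoluteValue.abs_apply,
          abs_mul, abs_inv, abs_of_pos hη]
        rw [inv_mul_le_iff₀ hη, mul_comm]
        exact hvK j
      · simp only [Matrix.updateCol_ne hk, AbsoluteValue.abs_apply]
        exact hK j k
  have h1 : (1 : ℝ) ≤ |R.det| := by
    rw [hRdet, ← Int.cast_abs]
    exact_mod_cast Int.one_le_abs hdet
  calc |b i| ≤ |R.det| * |b i| := le_mul_of_one_le_left (abs_nonneg _) h1
    _ = |(R.updateCol i v).det| := by rw [← abs_mul, hcr]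
    _ = η * |(R.updateCol i (η⁻¹ • v)).det| := by
      conv_lhs => rw [hscale, Matrix.det_updateCol_smul]
      rw [abs_mul, abs_of_pos hη]
    _ ≤ η * (s.factorial * K ^ s) := by gcongr
    _ = _ := by ring

/-- A finite-dimensional rational subspace of `ℝ` has coordinates, extended to all of `ℝ`, which are
integral and bounded on a given finite set. -/
theorem exists_integral_coordinates (V : Submodule ℚ ℝ) [Module.Finite ℚ V] {F : Set ℝ}
    (hF : F.Finite) {s : ℕ} (hs : Module.finrank ℚ V = s) :
    ∃ (φ : ℝ →ₗ[ℚ] (Fin s → ℚ)) (b : Fin s → ℝ) (B : ℕ),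
      (∀ i, b i ≠ 0) ∧ (∀ v ∈ V, v = ∑ i, (φ v i : ℝ) * b i) ∧ 0 < B ∧
      ∀ f ∈ F, ∀ i, ∃ z : ℤ, φ f i = z ∧ |z| ≤ B := by
  classical
  subst hs
  obtain ⟨π, hπ⟩ := LinearMap.exists_leftInverse_of_injective V.subtype V.ker_subtype
  have hπ' : ∀ v : V, π v = v := fun v => LinearMap.congr_fun hπ v
  let e := Module.finBasis ℚ V
  let ψ : ℝ →ₗ[ℚ] (Fin (Module.finrank ℚ V) → ℚ) := e.equivFun.toLinearMap ∘ₗ π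
  obtain ⟨q, hq⟩ := IsLocalization.exist_integer_multiples_of_finset (nonZeroDivisors ℤ)
    ((hF.toFinset ×ˢ Finset.univ).image fun y => ψ y.1 y.2)
  have hq0 : ((q : ℤ) : ℚ) ≠ 0 := by exact_mod_cast nonZeroDivisors.ne_zero q.2
  have hqR : ((q : ℤ) : ℝ) ≠ 0 := by exact_mod_cast nonZeroDivisors.ne_zero q.2
  have hint : ∀ f ∈ F, ∀ i, ∃ z : ℤ, (((q : ℤ) : ℚ) • ψ) f i = z := fun f hf i => by
    obtain ⟨z, hz⟩ := hq (ψ f i) (Finset.mem_image.2 ⟨(f, i), by simpa using hf, rfl⟩)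
    refine ⟨z, ?_⟩
    simp only [LinearMap.smul_apply, Pi.smul_apply, smul_eq_mul]
    simpa using hz.symm
  choose! z hz using hint
  refine ⟨((q : ℤ) : ℚ) • ψ, fun i => ((q : ℤ) : ℝ)⁻¹ * (e i : ℝ),
    ∑ f ∈ hF.toFinset, ∑ i, (z f i).natAbs + 1, fun i => ?_, fun v hv => ?_, by positivity,
    fun f hf i => ⟨z f i, hz f hf i, ?_⟩⟩
  · refine mul_ne_zero (inv_ne_zero hqR) ?_
    exact fun h => e.ne_zero i (Subtype.ext h)
  · have h := congrArg (Subtype.val) (e.sum_equivFun ⟨v, hv⟩)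
    simp only [AddSubmonoidClass.coe_finsetSum, Submodule.coe_smul] at h
    conv_lhs => rw [← h]
    refine Finset.sum_congr rfl fun i _ => ?_
    have : ψ v i = e.equivFun ⟨v, hv⟩ i := by
      simp only [ψ, LinearMap.comp_apply]
      rw [hπ' ⟨v, hv⟩]
      rfl
    rw [LinearMap.smul_apply, Pi.smul_apply, this, Rat.smul_def, smul_eq_mul]
    push_cast
    field_simp
  · rw [Int.abs_eq_natAbs]
    norm_cast
    calc (z f i).natAbs ≤ ∑ i, (z f i).natAbs :=
          Finset.single_le_sum (f := fun i => (z f i).natAbs) (fun _ _ => Nat.zero_le _)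
            (Finset.mem_univ i)
      _ ≤ ∑ f ∈ hF.toFinset, ∑ i, (z f i).natAbs :=
          Finset.single_le_sum (f := fun f => ∑ i, (z f i).natAbs) (fun _ _ => Nat.zero_le _)
            (hF.mem_toFinset.2 hf)
      _ ≤ _ := Nat.le_succ _

theorem floor_two_pow_mul_eq (j : ℕ) (x : ℝ) :
    ⌊(2 : ℝ) ^ j * x⌋ = ⌊(2 : ℝ) ^ (j + 1) * x⌋ / 2 := by
  have h := Int.floor_div_natCast ((2 : ℝ) ^ (j + 1) * x) 2
  rw [Nat.cast_ofNat, Nat.cast_ofNat] at h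
  rw [← h, pow_succ]
  congr 1
  ring

theorem finite_range_floor {X : ℕ → ℝ} (hX : ∀ n, X n ∈ Ico (0 : ℝ) 1) (j : ℕ) :
    (range fun n => ⌊(2 : ℝ) ^ j * X n⌋).Finite := by
  refine (Set.finite_Icc (0 : ℤ) (2 ^ j)).subset ?_
  rintro _ ⟨n, rfl⟩
  obtain ⟨h0, h1⟩ := hX n
  refine ⟨Int.floor_nonneg.2 (by positivity), ?_⟩
  rw [← Int.cast_le (R := ℝ)]
  refine (Int.floor_le _).trans ?_
  push_cast
  exact mul_le_of_le_one_right (by positivity) h1.le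

/-- A bounded sequence with infinitely many values and finitely many steps, all in a rational space
of dimension `d`, visits at least a constant times `2 ^ (j / d)` dyadic intervals of
length `2 ^ (-j)`. The spans of the differences within dyadic cells decrease with `j`, hence
stabilize at some nonzero subspace, to which the determinant bound applies. -/
theorem two_pow_le_card_cells (X : ℕ → ℝ) (E : Submodule ℚ ℝ) [Module.Finite ℚ E]
    (hD : (range fun n => X (n + 1) - X n).Finite) (hE : ∀ n, X (n + 1) - X n ∈ E)
    (hX : ∀ n, X n ∈ Ico (0 : ℝ) 1) (hinf : (range X).Infinite) :
    ∃ C : ℝ, 0 < C ∧ ∃ j₀ : ℕ, ∀ j ≥ j₀,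
      (2 : ℝ) ^ j ≤ C * ((range fun n => ⌊(2 : ℝ) ^ j * X n⌋).ncard : ℝ) ^ Module.finrank ℚ E := by
  set V : ℕ → Submodule ℚ ℝ := fun j =>
    Submodule.span ℚ {y | ∃ m n, ⌊(2 : ℝ) ^ j * X m⌋ = ⌊(2 : ℝ) ^ j * X n⌋ ∧ y = X m - X n} with hV
  have hXE : ∀ n, X n - X 0 ∈ E := fun n => by
    induction n with
    | zero => simp
    | succ n ih => simpa using E.add_mem (hE n) ih
  have hVE : ∀ j, V j ≤ E := fun j => by
    rw [hV, Submodule.span_le]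
    rintro _ ⟨m, n, -, rfl⟩
    simpa using E.sub_mem (hXE m) (hXE n)
  have hfinV : ∀ j, Module.Finite ℚ (V j) := fun j => Submodule.finiteDimensional_of_le (hVE j)
  have hanti : Antitone V := antitone_nat_of_succ_le fun j => by
    refine Submodule.span_mono ?_
    rintro _ ⟨m, n, h, rfl⟩
    exact ⟨m, n, by rw [floor_two_pow_mul_eq, floor_two_pow_mul_eq j (X n), h], rfl⟩
  obtain ⟨j₀, hj₀⟩ : ∃ j₀, ∀ j, Module.finrank ℚ (V j₀) ≤ Module.finrank ℚ (V j) :=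
    ⟨_, fun j => Function.argmin_le (fun j => Module.finrank ℚ (V j)) j⟩
  have hstab : ∀ j ≥ j₀, V j = V j₀ := fun j hj =>
    Submodule.eq_of_le_of_finrank_le (hanti hj) (hj₀ j)
  have hpos : 0 < Module.finrank ℚ (V j₀) := by
    rw [Nat.pos_iff_ne_zero, Ne, Submodule.finrank_eq_zero]
    intro h0
    apply hinf
    have hfac : ∀ m n, ⌊(2 : ℝ) ^ j₀ * X m⌋ = ⌊(2 : ℝ) ^ j₀ * X n⌋ → X m = X n := fun m n h => by
      have : X m - X n ∈ V j₀ := Submodule.subset_span ⟨m, n, h, rfl⟩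
      rw [h0, Submodule.mem_bot] at this
      linarith
    have hf : Function.FactorsThrough X fun n => ⌊(2 : ℝ) ^ j₀ * X n⌋ := fun m n h => hfac m n h
    rw [← hf.extend_comp (fun _ => 0), range_comp]
    exact (finite_range_floor hX j₀).image _
  obtain ⟨s, hs⟩ : ∃ s, Module.finrank ℚ (V j₀) = s := ⟨_, rfl⟩
  have hsE : s ≤ Module.finrank ℚ E := hs ▸ Submodule.finrank_mono (hVE j₀)
  obtain ⟨φ, b, B, hb, hφ, hB, hφF⟩ := exists_integral_coordinates (V j₀) hD hs
  rw [hs] at hpos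
  set i₀ : Fin s := ⟨0, hpos⟩
  refine ⟨s.factorial * (4 * B) ^ s / |b i₀|,
    div_pos (by positivity) (abs_pos.2 (hb i₀)), j₀, fun j hj => ?_⟩
  set N := (range fun n => ⌊(2 : ℝ) ^ j * X n⌋).ncard with hN
  have hN1 : (1 : ℝ) ≤ N := by
    rw [Nat.one_le_cast]
    exact (Set.ncard_pos (finite_range_floor hX j)).2 (range_nonempty _)
  have h2 : (0 : ℝ) < 2 ^ j := by positivity
  obtain ⟨v, hspan, hvint, hvabs⟩ := exists_short_cycles X (fun n => ⌊(2 : ℝ) ^ j * X n⌋)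
    ((2 : ℝ) ^ j)⁻¹ B φ (finite_range_floor hX j)
    (fun m n h => by
      have := Int.abs_sub_lt_one_of_floor_eq_floor h
      rw [← mul_sub, abs_mul, abs_of_pos h2] at this
      rw [← one_div, le_div_iff₀ h2]
      linarith)
    (fun n i => hφF _ ⟨n, rfl⟩ i)
  replace hspan : Submodule.span ℚ (range v) = V j₀ := hspan.trans (hstab j hj)
  have hfv : Module.Finite ℚ (Submodule.span ℚ (range v)) := hspan ▸ hfinV j₀
  obtain ⟨w, hwv, hwli⟩ : ∃ w : Fin s → ℝ, (∀ i, w i ∈ range v) ∧ LinearIndependent ℚ w := by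
    obtain ⟨w, hwv, -, hwli⟩ := Submodule.exists_fun_fin_finrank_span_eq ℚ (range v)
    have hcard : s = Module.finrank ℚ (Submodule.span ℚ (range v)) := by rw [hspan, hs]
    exact ⟨w ∘ Fin.cast hcard, fun i => hwv _, hwli.comp _ (Fin.cast_injective hcard)⟩
  choose k hk using hwv
  choose z hz hzB using hvint
  have hmain := abs_coeff_le_of_small_forms b w (Matrix.of fun i l => z (k i) l) hwli
    (fun i => by
      have hmem : w i ∈ V j₀ := hspan ▸ Submodule.subset_span ⟨k i, hk i⟩
      conv_lhs => rw [hφ _ hmem]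
      refine Finset.sum_congr rfl fun l _ => ?_
      rw [← hk i, hz]
      simp)
    (4 * N * B) ((2 : ℝ) ^ j)⁻¹ (by positivity)
    (fun i l => by
      have : |z (k i) l| ≤ 4 * N * B := hzB (k i) l
      rw [Matrix.of_apply]
      exact_mod_cast this)
    (fun i => by
      rw [← hk i]
      refine (hvabs (k i)).trans ?_
      rw [mul_assoc (4 * (N : ℝ))]
      gcongr
      exact le_mul_of_one_le_left (by positivity) (by exact_mod_cast hB))
    i₀
  have hb0 : 0 < |b i₀| := abs_pos.2 (hb i₀)
  rw [← div_eq_mul_inv, le_div_iff₀ h2] at hmain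
  calc (2 : ℝ) ^ j ≤ s.factorial * (4 * N * B) ^ s / |b i₀| := by
        rw [le_div_iff₀ hb0, mul_comm]
        exact hmain
    _ = s.factorial * (4 * B) ^ s / |b i₀| * (N : ℝ) ^ s := by
        rw [show (4 * N * B : ℝ) = 4 * B * N by ring, mul_pow (4 * (B : ℝ))]
        ring
    _ ≤ _ := by gcongr

theorem exists_coe_eq (y : AddCircle (1 : ℝ)) :
    ∃ Y ∈ Ico (0 : ℝ) 1, (Y : AddCircle (1 : ℝ)) = y := by
  have h := (AddCircle.equivIco (1 : ℝ) 0 y).2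
  exact ⟨_, ⟨h.1, h.2.trans_eq (zero_add 1)⟩, (AddCircle.equivIco (1 : ℝ) 0).symm_apply_apply y⟩

theorem exists_cover (A : Set (AddCircle (1 : ℝ))) {δ : ℝ} (hδ : 0 < δ) :
    ∃ S : Finset (AddCircle (1 : ℝ)), (S.card : ℝ) ≤ 1 / δ + 2 ∧
      A ⊆ ⋃ x ∈ S, closedBall x (δ / 2) := by
  classical
  refine ⟨(Finset.range (⌊1 / δ⌋₊ + 2)).image fun k : ℕ => ((k * δ : ℝ) : AddCircle (1 : ℝ)),
    ?_, ?_⟩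
  · refine (Nat.cast_le.2 Finset.card_image_le).trans ?_
    rw [Finset.card_range]
    push_cast
    have := Nat.floor_le (one_div_pos.2 hδ).le
    linarith
  · rintro y -
    obtain ⟨Y, ⟨hY0, hY1⟩, rfl⟩ := exists_coe_eq y
    have hpos : 0 ≤ Y / δ + 1 / 2 := by positivity
    have hle : Y / δ ≤ 1 / δ := by gcongr
    have h1 := Nat.floor_le hpos
    have h2 := Nat.lt_floor_add_one (Y / δ + 1 / 2)
    have h3 := Nat.lt_floor_add_one (1 / δ)
    set k := ⌊Y / δ + 1 / 2⌋₊
    have hk : k < ⌊1 / δ⌋₊ + 2 := by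
      rw [← Nat.cast_lt (α := ℝ)]
      push_cast
      linarith
    refine mem_biUnion (Finset.mem_coe.2 (Finset.mem_image_of_mem _ (Finset.mem_range.2 hk))) ?_
    rw [mem_closedBall, dist_eq_norm, ← AddCircle.coe_sub, UnitAddCircle.norm_eq]
    refine (round_le _ 0).trans ?_
    have hYd : Y - k * δ = (Y / δ - k) * δ := by field_simp
    have habs : |Y / δ - k| ≤ 1 / 2 := abs_le.2 ⟨by linarith, by linarith⟩
    rw [Int.cast_zero, sub_zero, hYd, abs_mul, abs_of_pos hδ]
    nlinarith

theorem exists_cover_card_eq_coverNum (A : Set (AddCircle (1 : ℝ))) {δ : ℝ} (hδ : 0 < δ) :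
    ∃ S : Finset (AddCircle (1 : ℝ)), S.card = coverNum A δ ∧
      A ⊆ ⋃ x ∈ S, closedBall x (δ / 2) := by
  obtain ⟨S, -, hS⟩ := exists_cover A hδ
  exact Nat.sInf_mem (s := {n : ℕ | ∃ S : Finset (AddCircle (1 : ℝ)), S.card = n ∧
    A ⊆ ⋃ x ∈ S, closedBall x (δ / 2)}) ⟨S.card, S, rfl, hS⟩

theorem coverNum_le (A : Set (AddCircle (1 : ℝ))) {δ : ℝ} (hδ : 0 < δ) :
    (coverNum A δ : ℝ) ≤ 1 / δ + 2 := by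
  obtain ⟨S, hcard, hS⟩ := exists_cover A hδ
  have hle : coverNum A δ ≤ S.card := Nat.sInf_le ⟨S, rfl, hS⟩
  exact (Nat.cast_le.2 hle).trans hcard

/-- An arc of length at most `2 ^ (-j)` meets at most nine dyadic cells of that length. -/
theorem card_cells_le {X : ℕ → ℝ} (hX : ∀ n, X n ∈ Ico (0 : ℝ) 1) (j : ℕ) {δ : ℝ}
    (hδ1 : δ ≤ 1) (hδj : δ ≤ ((2 : ℝ) ^ j)⁻¹) (S : Finset (AddCircle (1 : ℝ)))
    (hS : ∀ n, ∃ y ∈ S, ((X n : ℝ) : AddCircle (1 : ℝ)) ∈ closedBall y (δ / 2)) :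
    (range fun n => ⌊(2 : ℝ) ^ j * X n⌋).ncard ≤ 9 * S.card := by
  classical
  choose L hL hLy using exists_coe_eq
  let T : Finset ℤ := (S ×ˢ (Finset.Icc (-1 : ℤ) 1 ×ˢ Finset.Icc (-1 : ℤ) 1)).image
    fun q => ⌊(2 : ℝ) ^ j * L q.1⌋ + 2 ^ j * q.2.1 + q.2.2
  have hsub : (range fun n => ⌊(2 : ℝ) ^ j * X n⌋) ⊆ T := by
    rintro _ ⟨n, rfl⟩
    obtain ⟨y, hy, hball⟩ := hS n
    rw [← hLy y, mem_closedBall, dist_eq_norm, ← AddCircle.coe_sub, UnitAddCircle.norm_eq] at hball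
    obtain ⟨hX0, hX1⟩ := hX n
    obtain ⟨hL0, hL1⟩ := hL y
    set k := round (X n - L y)
    obtain ⟨hb1, hb2⟩ := abs_le.1 hball
    have hk1 : -1 ≤ k := by
      have : (-2 : ℝ) < k := by linarith
      have : -2 < k := by exact_mod_cast this
      omega
    have hk2 : k ≤ 1 := by
      have : (k : ℝ) < 2 := by linarith
      have : k < 2 := by exact_mod_cast this
      omega
    have h2 : (0 : ℝ) < 2 ^ j := by positivity
    have hδ2 : (2 : ℝ) ^ j * δ ≤ 1 := by
      rw [← one_div, le_div_iff₀ h2] at hδj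
      linarith
    have hc1 : (2 : ℝ) ^ j * (X n - L y - k) ≤ 1 / 2 := by nlinarith
    have hc2 : -(1 / 2) ≤ (2 : ℝ) ^ j * (X n - L y - k) := by nlinarith
    have f1 := Int.floor_le ((2 : ℝ) ^ j * X n)
    have f2 := Int.lt_floor_add_one ((2 : ℝ) ^ j * X n)
    have f3 := Int.floor_le ((2 : ℝ) ^ j * L y)
    have f4 := Int.lt_floor_add_one ((2 : ℝ) ^ j * L y)
    have e1 : ⌊(2 : ℝ) ^ j * X n⌋ - (⌊(2 : ℝ) ^ j * L y⌋ + 2 ^ j * k) < 2 := by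
      rw [← Int.cast_lt (R := ℝ)]
      push_cast
      linarith
    have e2 : -2 < ⌊(2 : ℝ) ^ j * X n⌋ - (⌊(2 : ℝ) ^ j * L y⌋ + 2 ^ j * k) := by
      rw [← Int.cast_lt (R := ℝ)]
      push_cast
      linarith
    refine Finset.mem_coe.2 (Finset.mem_image.2
      ⟨(y, k, ⌊(2 : ℝ) ^ j * X n⌋ - (⌊(2 : ℝ) ^ j * L y⌋ + 2 ^ j * k)), ?_, by ring⟩)
    simp only [Finset.mem_product, Finset.mem_Icc]
    exact ⟨hy, ⟨hk1, hk2⟩, by omega, by omega⟩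
  calc _ ≤ (T : Set ℤ).ncard := Set.ncard_le_ncard hsub T.finite_toSet
    _ = T.card := Set.ncard_coe_finset T
    _ ≤ _ := Finset.card_image_le
    _ = 9 * S.card := by
      rw [Finset.card_product, Finset.card_product, Int.card_Icc, mul_comm]
      rfl

theorem le_lowerBoxDim (A : Set (AddCircle (1 : ℝ))) {d : ℕ} (hd : 0 < d) {C : ℝ} (hC : 0 < C)
    (h : ∀ᶠ δ : ℝ in nhdsWithin 0 (Ioi 0), 1 / δ ≤ C * (coverNum A δ : ℝ) ^ d) :
    1 / (d : ℝ) ≤ lowerBoxDim A := by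
  have hlog : Tendsto (fun δ : ℝ => Real.log (1 / δ)) (nhdsWithin 0 (Ioi 0)) atTop := by
    simp only [one_div]
    exact Real.tendsto_log_atTop.comp tendsto_inv_nhdsGT_zero
  have hsmall : ∀ᶠ δ : ℝ in nhdsWithin 0 (Ioi 0), 0 < δ ∧ δ < 1 / 2 :=
    Ioo_mem_nhdsGT (by norm_num)
  have hd' : (0 : ℝ) < d := by exact_mod_cast hd
  have hcob : IsCoboundedUnder (· ≥ ·) (nhdsWithin (0 : ℝ) (Ioi 0))
      fun δ : ℝ => Real.log (coverNum A δ) / Real.log (1 / δ) := by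
    refine IsBoundedUnder.isCoboundedUnder_ge ⟨2, ?_⟩
    rw [eventually_map]
    filter_upwards [hsmall, h] with δ ⟨hδ0, hδ⟩ hN
    have h2 : 2 < 1 / δ := by
      rw [lt_div_iff₀ hδ0]
      linarith
    have hlogpos : 0 < Real.log (1 / δ) := Real.log_pos (by linarith)
    have hNpos : (0 : ℝ) < coverNum A δ := by
      rcases (Nat.cast_nonneg (α := ℝ) (coverNum A δ)).lt_or_eq with h0 | h0
      · exact h0
      · rw [← h0, zero_pow hd.ne', mul_zero] at hN
        linarith
    rw [div_le_iff₀ hlogpos]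
    calc Real.log (coverNum A δ) ≤ Real.log ((1 / δ) ^ 2) := by
          refine Real.log_le_log hNpos ((coverNum_le A hδ0).trans ?_)
          nlinarith
      _ = 2 * Real.log (1 / δ) := by rw [Real.log_pow]; norm_num
  refine le_of_forall_pos_sub_le fun ε hε => ?_
  refine le_liminf_of_le hcob ?_
  filter_upwards [hsmall, h, hlog.eventually_ge_atTop (Real.log C / (d * ε))]
    with δ ⟨hδ0, hδ⟩ hN hlarge
  have h2 : 2 < 1 / δ := by
    rw [lt_div_iff₀ hδ0]
    linarith
  have hlogpos : 0 < Real.log (1 / δ) := Real.log_pos (by linarith)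
  have hNne : (coverNum A δ : ℝ) ^ d ≠ 0 := fun h0 => by
    rw [h0, mul_zero] at hN
    linarith
  have hlogle := Real.log_le_log (by linarith) hN
  rw [Real.log_mul hC.ne' hNne, Real.log_pow] at hlogle
  rw [div_le_iff₀ (by positivity)] at hlarge
  rw [le_div_iff₀ hlogpos, ← mul_le_mul_iff_right₀ hd']
  have : (d : ℝ) * ((1 / d - ε) * Real.log (1 / δ)) =
      Real.log (1 / δ) - Real.log (1 / δ) * (d * ε) := by
    field_simp
  linarith

theorem stmt12 (ℓ : ℕ) (hℓ : 2 ≤ ℓ) (α : Fin ℓ → ℝ) (r : ℕ) (hr : 1 < r)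
    (hrank : Module.rank ℚ
      (Submodule.span ℚ (insert (1 : ℝ) (Set.range α)) : Submodule ℚ ℝ) = r + 1)
    (x : ℕ → AddCircle (1 : ℝ))
    (horbit : ∀ n : ℕ, ∃ i : Fin ℓ, x (n + 1) - x n = ((α i : ℝ) : AddCircle (1 : ℝ)))
    (hinf : (Set.range x).Infinite) :
    1 / (r + 1 : ℝ) ≤ lowerBoxDim (closure (Set.range x)) := by
  set E : Submodule ℚ ℝ := Submodule.span ℚ (insert (1 : ℝ) (range α)) with hEdef
  have hfinE : Module.Finite ℚ E := Module.Finite.span_of_finite ℚ ((finite_range α).insert 1)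
  have hrankE : Module.finrank ℚ E = r + 1 :=
    Module.finrank_eq_of_rank_eq (by rw [hrank]; push_cast; rfl)
  choose X hX hXx using fun n => exists_coe_eq (x n)
  have hstep : ∀ n, ∃ i, ∃ k : ℤ, X (n + 1) - X n = α i + k := fun n => by
    obtain ⟨i, hi⟩ := horbit n
    rw [← hXx, ← hXx, ← AddCircle.coe_sub, ← sub_eq_zero, ← AddCircle.coe_sub,
      AddCircle.coe_eq_zero_iff] at hi
    obtain ⟨k, hk⟩ := hi
    rw [zsmul_one] at hk
    exact ⟨i, k, by linarith⟩
  have hE : ∀ n, X (n + 1) - X n ∈ E := fun n => by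
    obtain ⟨i, k, hik⟩ := hstep n
    rw [hik]
    refine E.add_mem (Submodule.subset_span (mem_insert_of_mem _ ⟨i, rfl⟩)) ?_
    have := E.smul_mem (k : ℚ) (Submodule.subset_span (mem_insert 1 (range α)))
    simpa [Rat.smul_def] using this
  have hD : (range fun n => X (n + 1) - X n).Finite := by
    refine (finite_iUnion fun i : Fin ℓ =>
      ((finite_Icc ⌊-1 - α i⌋ ⌈1 - α i⌉).image fun k : ℤ => α i + k)).subset ?_
    rintro _ ⟨n, rfl⟩
    obtain ⟨i, k, hik⟩ := hstep n
    obtain ⟨h1, h2⟩ := hX n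
    obtain ⟨h3, h4⟩ := hX (n + 1)
    refine mem_iUnion.2 ⟨i, k, ⟨?_, ?_⟩, hik.symm⟩
    · rw [← Int.cast_le (R := ℝ)]
      exact (Int.floor_le _).trans (by linarith)
    · rw [← Int.cast_le (R := ℝ)]
      exact le_trans (by linarith) (Int.le_ceil _)
  have hXinf : (range X).Infinite := fun hfin => by
    apply hinf
    have : x = (fun y : ℝ => (y : AddCircle (1 : ℝ))) ∘ X := funext fun n => (hXx n).symm
    rw [this, range_comp]
    exact hfin.image _
  obtain ⟨C, hC, j₀, hcells⟩ := two_pow_le_card_cells X E hD hE hX hXinf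
  rw [hrankE] at hcells
  have key := le_lowerBoxDim (closure (range x)) (d := r + 1) (Nat.succ_pos r)
    (C := 2 * C * 9 ^ (r + 1)) (by positivity) ?_
  · simpa using key
  filter_upwards [Ioo_mem_nhdsGT (show (0 : ℝ) < ((2 : ℝ) ^ j₀)⁻¹ by positivity)]
    with δ ⟨hδ0, hδ⟩
  have hinv : (2 : ℝ) ^ j₀ < 1 / δ := by
    rw [one_div]
    exact (lt_inv_comm₀ hδ0 (by positivity)).1 hδ
  have hone : (1 : ℝ) ≤ 1 / δ := (one_le_pow₀ one_le_two).trans hinv.le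
  obtain ⟨j, hj1, hj2⟩ := exists_nat_pow_near hone (one_lt_two (α := ℝ))
  have hj : j₀ ≤ j := by
    have := (pow_lt_pow_iff_right₀ (one_lt_two (α := ℝ))).1 (hinv.trans hj2)
    omega
  have hδj : δ ≤ ((2 : ℝ) ^ j)⁻¹ := by
    rw [one_div] at hj1
    exact (le_inv_comm₀ (by positivity) hδ0).1 hj1
  have hδ1 : δ ≤ 1 := by
    rw [le_div_iff₀ hδ0] at hone
    linarith
  obtain ⟨S, hcard, hS⟩ := exists_cover_card_eq_coverNum (closure (range x)) hδ0
  have hcount := card_cells_le hX j hδ1 hδj S fun n => by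
    have := hS (subset_closure (mem_range_self n))
    rw [hXx n]
    simpa using this
  rw [hcard] at hcount
  have hcount' : ((range fun n => ⌊(2 : ℝ) ^ j * X n⌋).ncard : ℝ) ≤
      9 * coverNum (closure (range x)) δ := by exact_mod_cast hcount
  calc 1 / δ ≤ 2 * 2 ^ j := by rw [pow_succ] at hj2; linarith
    _ ≤ 2 * (C * ((range fun n => ⌊(2 : ℝ) ^ j * X n⌋).ncard : ℝ) ^ (r + 1)) := by
      gcongr
      exact hcells j hj
    _ ≤ 2 * (C * (9 * coverNum (closure (range x)) δ) ^ (r + 1)) := by gcongr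
    _ = _ := by rw [mul_pow]; ring
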